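/- Let Ω ⊂ ℝᴺ be a bounded open set and ψ : ∂Ω → ℝ continuous. Let fₐ : [0,∞) → ℝ be strictly convex, continuously differentiable on [0,∞), twice continuously differentiable on (0,∞) with f''ₐ locally Hölder continuous, with f'ₐ(0) = 0, and assume the limit ℓ := lim_{ρ→0⁺} ρ f''ₐ(ρ)/f'ₐ(ρ) exists and is finite; set αₐ(ρ) = ρ f''ₐ(ρ)/f'ₐ(ρ) for ρ > 0 and αₐ(0) = ℓ. If uₐ is Lipschitz on the closure of Ω, uₐ = ψ on ∂Ω, and uₐ minimizes Jₐ(w) = ∫_Ω fₐ(‖∇w‖) dx among all Lipschitz w with w = ψ on ∂Ω, then uₐ is a viscosity solution in Ω of −[αₐ(‖∇u‖) − 1]·Δ∞u − ‖∇u‖²·Δu = 0. -/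

import Mathlib

open Set MeasureTheory Metric Filter
open scoped RealInnerProductSpace Topology Classical

noncomputable section

abbrev EN (N : ℕ) := EuclideanSpace ℝ (Fin N)

/-- A function is Lipschitz on a set (with some constant). -/
def LipOn {N : ℕ} (w : EN N → ℝ) (s : Set (EN N)) : Prop := ∃ L : NNReal, LipschitzOnWith L w s

/-- The functional `J(w) = ∫_Ω f(‖∇w‖)`, with `∇w` the a.e.-defined (Rademacher) gradient. -/
def J {N : ℕ} (f : ℝ → ℝ) (Ω : Set (EN N)) (w : EN N → ℝ) : ℝ := ∫ x in Ω, f ‖gradient w x‖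

/-- The (one-sided at `0`) derivative of `f` on `[0,∞)`. -/
def dtop (f : ℝ → ℝ) : ℝ → ℝ := derivWithin f (Set.Ici 0)

/-- Standing assumptions on the Lagrangian `f`. -/
def StdF (f : ℝ → ℝ) : Prop :=
  StrictConvexOn ℝ (Set.Ici 0) f ∧ ContDiffOn ℝ 1 f (Set.Ici 0) ∧
  ContDiffOn ℝ 2 f (Set.Ioi 0) ∧
  (∃ lam : NNReal, 0 < lam ∧ lam < 1 ∧ ∀ K : Set ℝ, IsCompact K → K ⊆ Set.Ioi 0 →
    ∃ C : NNReal, HolderOnWith C lam (deriv (dtop f)) K) ∧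
  0 < dtop f 0

/-- `u` solves the variational problem (P) for the Lagrangian `f`. -/
def SolvesP {N : ℕ} (f : ℝ → ℝ) (Ω : Set (EN N)) (ψ u : EN N → ℝ) : Prop :=
  LipOn u (closure Ω) ∧ EqOn u ψ (frontier Ω) ∧
  ∀ w : EN N → ℝ, LipOn w (closure Ω) → EqOn w ψ (frontier Ω) → J f Ω u ≤ J f Ω w

/-- `(Ω, ψ)` satisfies the bounded slope condition with constant `Q`. -/
def BSC {N : ℕ} (Ω : Set (EN N)) (ψ : EN N → ℝ) (Q : ℝ) : Prop :=
  ∀ x₀ ∈ frontier Ω, ∃ a b : EN N, ∃ c d : ℝ,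
    ‖a‖ ≤ Q ∧ ‖b‖ ≤ Q ∧
    (∀ x ∈ frontier Ω, ⟪a, x⟫ + c ≤ ψ x ∧ ψ x ≤ ⟪b, x⟫ + d) ∧
    ⟪a, x₀⟫ + c = ψ x₀ ∧ ⟪b, x₀⟫ + d = ψ x₀

/-- `w` is a viscosity solution of `F(∇w, ∇²w) = 0` in `Ω`: `w` is continuous on `Ω` and, for
every `C²` test function `φ` such that `w − φ` has a local maximum (resp. minimum) on `Ω` at
`x`, one has `F(∇φ(x), ∇²φ(x)) ≤ 0` (resp. `≥ 0`). The Hessian is encoded as the operator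
`fderiv ℝ (gradient φ) x`. -/
def ViscositySol {N : ℕ} (Ω : Set (EN N)) (F : EN N → (EN N →L[ℝ] EN N) → ℝ)
    (w : EN N → ℝ) : Prop :=
  ContinuousOn w Ω ∧
  (∀ x ∈ Ω, ∀ φ : EN N → ℝ, ContDiff ℝ 2 φ →
    IsLocalMaxOn (fun y => w y - φ y) Ω x →
    F (gradient φ x) (fderiv ℝ (gradient φ) x) ≤ 0) ∧
  (∀ x ∈ Ω, ∀ φ : EN N → ℝ, ContDiff ℝ 2 φ →
    IsLocalMinOn (fun y => w y - φ y) Ω x →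
    0 ≤ F (gradient φ x) (fderiv ℝ (gradient φ) x))

theorem dtop_eq_deriv {f : ℝ → ℝ} {ρ : ℝ} (hρ : 0 < ρ) : dtop f ρ = deriv f ρ :=
  derivWithin_of_mem_nhds (Ici_mem_nhds hρ)

theorem contDiffAt_dtop {f : ℝ → ℝ} (hC2 : ContDiffOn ℝ 2 f (Ioi 0)) {ρ : ℝ} (hρ : 0 < ρ) :
    ContDiffAt ℝ 1 (dtop f) ρ := by
  have h : ContDiffOn ℝ 1 (deriv f) (Ioi 0) := by
    rw [show (2 : WithTop ℕ∞) = 1 + 1 by norm_num, contDiffOn_succ_iff_deriv_of_isOpen isOpen_Ioi] at hC2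
    exact hC2.2.2
  refine (h.contDiffAt (Ioi_mem_nhds hρ)).congr_of_eventuallyEq ?_
  filter_upwards [Ioi_mem_nhds hρ] with t ht using dtop_eq_deriv ht

theorem dtop_pos {f : ℝ → ℝ} (hconv : StrictConvexOn ℝ (Ici 0) f)
    (hC1 : ContDiffOn ℝ 1 f (Ici 0)) (h0 : dtop f 0 = 0) {ρ : ℝ} (hρ : 0 < ρ) :
    0 < dtop f ρ := by
  have h := hconv.strictMonoOn_derivWithin (hC1.differentiableOn one_ne_zero)
    self_mem_Ici (mem_Ici.2 hρ.le) hρ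
  unfold dtop at *
  linarith

theorem tangent_le {f : ℝ → ℝ} (hconv : ConvexOn ℝ (Ici 0) f)
    (hC1 : ContDiffOn ℝ 1 f (Ici 0)) {s t : ℝ} (hs : 0 ≤ s) (ht : 0 ≤ t) :
    f s + dtop f s * (t - s) ≤ f t := by
  have hd := hC1.differentiableOn one_ne_zero s hs
  rcases lt_trichotomy s t with h | rfl | h
  · have := hconv.derivWithin_le_slope hs ht h hd
    rw [slope_def_field, le_div_iff₀ (sub_pos.2 h)] at this
    unfold dtop
    linarith
  · simp
  · have := hconv.slope_le_derivWithin ht hs h hd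
    rw [slope_def_field, div_le_iff₀ (sub_pos.2 h)] at this
    unfold dtop
    linarith

/-- The subgradient inequality for the radial convex function `p ↦ f ‖p‖`. -/
theorem radial_tangent_le {N : ℕ} {f : ℝ → ℝ} (hconv : StrictConvexOn ℝ (Ici 0) f)
    (hC1 : ContDiffOn ℝ 1 f (Ici 0)) (h0 : dtop f 0 = 0) {p q : EN N} (hp : p ≠ 0) :
    f ‖p‖ + ⟪(dtop f ‖p‖ / ‖p‖) • p, q - p⟫ ≤ f ‖q‖ := by
  have hp' : 0 < ‖p‖ := norm_pos_iff.2 hp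
  refine le_trans ?_ (tangent_le hconv.convexOn hC1 (norm_nonneg p) (norm_nonneg q))
  have h1 := real_inner_le_norm p q
  have h2 := (dtop_pos hconv hC1 h0 hp').le
  rw [real_inner_smul_left, inner_sub_right, real_inner_self_eq_norm_sq]
  have : dtop f ‖p‖ / ‖p‖ * (⟪p, q⟫ - ‖p‖ ^ 2) ≤ dtop f ‖p‖ / ‖p‖ * (‖p‖ * ‖q‖ - ‖p‖ ^ 2) := by
    gcongr
  have e : dtop f ‖p‖ / ‖p‖ * (‖p‖ * ‖q‖ - ‖p‖ ^ 2) = dtop f ‖p‖ * (‖q‖ - ‖p‖) := by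
    field_simp
  linarith

theorem inner_gradient_eq_sum {N : ℕ} {η : EN N → ℝ} {x : EN N} (hη : DifferentiableAt ℝ η x)
    (v : EN N) :
    ⟪v, gradient η x⟫ = ∑ i, lineDeriv ℝ η x (EuclideanSpace.single i 1) * v i := by
  rw [real_inner_comm, inner_gradient_left]
  conv_lhs => rw [← (EuclideanSpace.basisFun (Fin N) ℝ).sum_repr v]
  simp [hη.lineDeriv_eq_fderiv, mul_comm]

theorem integral_lineDeriv_sum_eq {N : ℕ} {η : EN N → ℝ} {K : NNReal} (hη : LipschitzWith K η)
    {V : EN N → EN N} (hV : ContDiff ℝ 1 V) (hVc : HasCompactSupport V) :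
    Integrable (fun x => ∑ i, lineDeriv ℝ η x (EuclideanSpace.single i 1) * V x i) ∧
    ∫ x, ∑ i, lineDeriv ℝ η x (EuclideanSpace.single i 1) * V x i =
      -∫ x, LinearMap.trace ℝ (EN N) (fderiv ℝ V x).toLinearMap * η x := by
  have hVi : ∀ i, ContDiff ℝ 1 (fun x => V x i) := fun i =>
    (EuclideanSpace.proj i : EN N →L[ℝ] ℝ).contDiff.comp hV
  have hVic : ∀ i, HasCompactSupport (fun x => V x i) := fun i =>
    hVc.comp_left (g := fun v : EN N => v i) rfl
  have hint : ∀ i, Integrable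
      (fun x => lineDeriv ℝ η x (EuclideanSpace.single i 1) * V x i) := fun i =>
    ((hVi i).continuous.integrable_of_hasCompactSupport (hVic i)).bdd_mul
      (c := K * ‖(EuclideanSpace.single i 1 : EN N)‖)
      (hη.memLp_lineDeriv _).aestronglyMeasurable
      (Eventually.of_forall fun x => norm_lineDeriv_le_of_lipschitz ℝ hη)
  have hdc : ∀ v : EN N, ∀ i, Continuous (fun x => fderiv ℝ (fun x => V x i) x v) := fun v i =>
    ((hVi i).continuous_fderiv one_ne_zero).clm_apply continuous_const
  have hlin : ∀ i x v, lineDeriv ℝ (fun x => V x i) x v = fderiv ℝ (fun x => V x i) x v :=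
    fun i x v => ((hVi i).differentiable one_ne_zero x).lineDeriv_eq_fderiv
  have hint2 : ∀ i, Integrable
      (fun x => lineDeriv ℝ (fun x => V x i) x (-EuclideanSpace.single i 1) * η x) := fun i => by
    simp only [hlin]
    refine ((hdc _ i).mul hη.continuous).integrable_of_hasCompactSupport ?_
    exact ((hVic i).fderiv_apply (𝕜 := ℝ) _).mul_right
  refine ⟨integrable_finsetSum _ fun i _ => hint i, ?_⟩
  rw [integral_finsetSum _ fun i _ => hint i, ← integral_neg]
  have : ∀ i, ∫ x, lineDeriv ℝ η x (EuclideanSpace.single i 1) * V x i =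
      ∫ x, lineDeriv ℝ (fun x => V x i) x (-EuclideanSpace.single i 1) * η x := fun i => by
    obtain ⟨D, hD⟩ := (hVi i).lipschitzWith_of_hasCompactSupport (hVic i) one_ne_zero
    exact hη.integral_lineDeriv_mul_eq hD (hVic i) _
  simp only [this]
  rw [← integral_finsetSum _ fun i _ => hint2 i]
  congr 1 with x
  rw [LinearMap.trace_eq_sum_inner _ (EuclideanSpace.basisFun (Fin N) ℝ), ← neg_mul,
    ← Finset.sum_neg_distrib, Finset.sum_mul]
  refine Finset.sum_congr rfl fun i _ => ?_
  have h1 : fderiv ℝ (fun x => V x i) x =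
      (EuclideanSpace.proj i : EN N →L[ℝ] ℝ).comp (fderiv ℝ V x) :=
    ((EuclideanSpace.proj i : EN N →L[ℝ] ℝ).hasFDerivAt.comp x
      (hV.differentiable one_ne_zero x).hasFDerivAt).fderiv
  rw [hlin, h1]
  simp [EuclideanSpace.inner_single_left]

theorem norm_gradient {N : ℕ} (w : EN N → ℝ) (x : EN N) : ‖gradient w x‖ = ‖fderiv ℝ w x‖ := by
  simp [gradient]

theorem integrableOn_lagrangian {N : ℕ} {Ω : Set (EN N)} (hΩo : IsOpen Ω)
    (hΩb : Bornology.IsBounded Ω) {f : ℝ → ℝ} (hf : ContinuousOn f (Ici 0)) {w : EN N → ℝ}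
    (hw : LipOn w (closure Ω)) : IntegrableOn (fun x => f ‖gradient w x‖) Ω := by
  obtain ⟨L, hL⟩ := hw
  have hb : ∀ x ∈ Ω, ‖fderiv ℝ w x‖ ≤ L := fun x hx =>
    norm_fderiv_le_of_lipschitzOn ℝ (hΩo.mem_nhds hx) (hL.mono subset_closure)
  have hg : Continuous (fun t => f (max 0 t)) :=
    hf.comp_continuous (by fun_prop) fun t => mem_Ici.2 (le_max_left _ _)
  have heq : (fun x => f ‖gradient w x‖) = fun x => f (max 0 ‖fderiv ℝ w x‖) := by
    ext x
    rw [norm_gradient, max_eq_right (norm_nonneg _)]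
  rw [heq]
  obtain ⟨C, hC⟩ := (isCompact_Icc (a := (0 : ℝ)) (b := L)).exists_bound_of_continuousOn
    hg.continuousOn
  refine Measure.integrableOn_of_bounded (M := C) hΩb.measure_lt_top.ne
    (hg.measurable.comp (measurable_fderiv ℝ w).norm).aestronglyMeasurable ?_
  filter_upwards [ae_restrict_mem hΩo.measurableSet] with x hx
  exact hC _ ⟨norm_nonneg _, hb x hx⟩

theorem trace_smulRight_comp {N : ℕ} (c k : ℝ) (H : EN N →L[ℝ] EN N) (p : EN N) :
    LinearMap.trace ℝ (EN N)
      (k • H + (c • (innerSL ℝ p).comp H).smulRight p : EN N →L[ℝ] EN N).toLinearMap =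
      k * LinearMap.trace ℝ (EN N) H.toLinearMap + c * ⟪H p, p⟫ := by
  have : ((c • (innerSL ℝ p).comp H).smulRight p : EN N →L[ℝ] EN N).toLinearMap =
      ((c • (innerSL ℝ p).comp H).toLinearMap).smulRight p := rfl
  rw [ContinuousLinearMap.toLinearMap_add, map_add, this, LinearMap.trace_smulRight,
    ContinuousLinearMap.toLinearMap_smul, map_smul]
  simp [real_inner_comm]

/-- A nonvanishing `C¹` field `P` at which the operator is positive gives a compactly supported
`C¹` field which coincides with the flux `f'(‖P‖) P / ‖P‖` near `x` and has negative divergence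
there. -/
theorem exists_flux_field {N : ℕ} {f : ℝ → ℝ} (hconv : StrictConvexOn ℝ (Ici 0) f)
    (hC1 : ContDiffOn ℝ 1 f (Ici 0)) (hC2 : ContDiffOn ℝ 2 f (Ioi 0)) (h0 : dtop f 0 = 0)
    {P : EN N → EN N} (hP : ContDiff ℝ 1 P) {x p : EN N} {H : EN N →L[ℝ] EN N}
    (hH : HasFDerivAt P H x) (hpx : P x = p) (hp : p ≠ 0) {U : Set (EN N)} (hU : U ∈ 𝓝 x)
    (hF : 0 < -(‖p‖ * deriv (dtop f) ‖p‖ / dtop f ‖p‖ - 1) * ⟪H p, p⟫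
        - ‖p‖ ^ 2 * LinearMap.trace ℝ (EN N) H.toLinearMap) :
    ∃ V : EN N → EN N, ContDiff ℝ 1 V ∧ HasCompactSupport V ∧ (∀ y ∉ U, V y = 0) ∧
      ∀ᶠ y in 𝓝 x, P y ≠ 0 ∧ V y = (dtop f ‖P y‖ / ‖P y‖) • P y ∧
        LinearMap.trace ℝ (EN N) (fderiv ℝ V y).toLinearMap < 0 := by
  have hp' : 0 < ‖p‖ := norm_pos_iff.2 hp
  have hD := dtop_pos hconv hC1 h0 hp'
  have hPne : ∀ᶠ y in 𝓝 x, P y ≠ 0 :=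
    hP.continuous.continuousAt.eventually_ne (hpx ▸ hp)
  obtain ⟨R, hR, hRU⟩ := nhds_basis_closedBall.mem_iff.1 (inter_mem hU hPne)
  let χ : ContDiffBump x := ⟨R / 2, R, by positivity, by linarith⟩
  let W : EN N → EN N := fun y => (dtop f ‖P y‖ / ‖P y‖) • P y
  have hW : ∀ y, P y ≠ 0 → ContDiffAt ℝ 1 W y := fun y hy => by
    have hn : ContDiffAt ℝ 1 (fun y => ‖P y‖) y := hP.contDiffAt.norm ℝ hy
    have hd : ContDiffAt ℝ 1 (fun y => dtop f ‖P y‖) y :=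
      (contDiffAt_dtop hC2 (norm_pos_iff.2 hy)).comp y hn
    exact (hd.div hn (norm_ne_zero_iff.2 hy)).smul hP.contDiffAt
  let V : EN N → EN N := fun y => χ y • W y
  have hts : tsupport V ⊆ closedBall x R := by
    refine (tsupport_smul_subset_left (fun y => χ y) W).trans ?_
    exact χ.tsupport_eq.subset
  have hV : ContDiff ℝ 1 V := by
    rw [contDiff_iff_contDiffAt]
    intro y
    by_cases hy : y ∈ tsupport V
    · exact χ.contDiff.contDiffAt.smul (hW y (hRU (hts hy)).2)
    · exact contDiffAt_const.congr_of_eventuallyEq (notMem_tsupport_iff_eventuallyEq.1 hy)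
  have hVW : ∀ᶠ y in 𝓝 x, V y = W y := by
    filter_upwards [closedBall_mem_nhds x (half_pos hR)] with y hy
    simp [V, χ.one_of_mem_closedBall hy]
  have hder : HasFDerivAt W ((dtop f ‖p‖ / ‖p‖) • H +
      (((deriv (dtop f) ‖p‖ * ‖p‖ - dtop f ‖p‖) / ‖p‖ ^ 3) •
        (innerSL ℝ p).comp H).smulRight p) x := by
    have hn : HasFDerivAt (fun y => ‖P y‖) (‖p‖⁻¹ • (innerSL ℝ p).comp H) x := by
      have h1 : HasFDerivAt (fun q : EN N => ‖q‖) (‖p‖⁻¹ • innerSL ℝ p) (P x) := by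
        have h2 := ((hasStrictFDerivAt_norm_sq p).hasFDerivAt).sqrt (by positivity)
        rw [hpx]
        refine (h2.congr_fderiv ?_).congr_of_eventuallyEq (.of_forall fun q => ?_)
        · ext q
          simp
          field_simp
        · simp
      exact h1.comp x hH
    have hk : HasDerivAt (fun ρ => dtop f ρ / ρ)
        ((deriv (dtop f) ‖p‖ * ‖p‖ - dtop f ‖p‖) / ‖p‖ ^ 2) ‖P x‖ := by
      rw [hpx]
      have := ((contDiffAt_dtop hC2 hp').differentiableAt one_ne_zero).hasDerivAt.div
        (hasDerivAt_id ‖p‖) hp'.ne'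
      exact this.congr_deriv (by simp)
    have := (hk.comp_hasFDerivAt x hn).smul hH
    rw [hpx] at this
    refine HasFDerivAt.congr_fderiv (f := W) this ?_
    simp only [hpx, Function.comp]
    congr 2
    rw [smul_smul]
    congr 1
    field_simp
  have htr : LinearMap.trace ℝ (EN N) (fderiv ℝ V x).toLinearMap < 0 := by
    rw [(hder.congr_of_eventuallyEq hVW).fderiv, trace_smulRight_comp]
    set T := LinearMap.trace ℝ (EN N) H.toLinearMap
    set Q := ⟪H p, p⟫
    have e : dtop f ‖p‖ / ‖p‖ * T + (deriv (dtop f) ‖p‖ * ‖p‖ - dtop f ‖p‖) / ‖p‖ ^ 3 * Q =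
        -(dtop f ‖p‖ / ‖p‖ ^ 3 * (-(‖p‖ * deriv (dtop f) ‖p‖ / dtop f ‖p‖ - 1) * Q
          - ‖p‖ ^ 2 * T)) := by
      field_simp
      ring
    rw [e, neg_lt_zero]
    positivity
  have hcont : Continuous fun y => LinearMap.trace ℝ (EN N) (fderiv ℝ V y).toLinearMap :=
    (LinearMap.continuous_of_finiteDimensional
      ((LinearMap.trace ℝ (EN N)).comp (ContinuousLinearMap.coeLM ℝ))).comp
      (hV.continuous_fderiv one_ne_zero)
  refine ⟨V, hV, HasCompactSupport.of_support_subset_isCompact (isCompact_closedBall x R)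
    ((subset_tsupport V).trans hts), fun y hy => ?_, ?_⟩
  · exact image_eq_zero_of_notMem_tsupport fun h => hy (hRU (hts h)).1
  · filter_upwards [hPne, hVW, hcont.continuousAt.eventually_lt_const htr] with y h1 h2 h3
    exact ⟨h1, h2, h3⟩

theorem contDiff_gradient {N : ℕ} {φ : EN N → ℝ} (hφ : ContDiff ℝ 2 φ) :
    ContDiff ℝ 1 (gradient φ) :=
  (InnerProductSpace.toDual ℝ (EN N)).symm.toContinuousLinearEquiv.contDiff.comp
    (hφ.fderiv_right (by norm_num))

theorem hasGradientAt_norm_sub_pow_four {N : ℕ} (x y : EN N) :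
    HasGradientAt (fun y => ‖y - x‖ ^ 4) ((4 * ‖y - x‖ ^ 2) • (y - x)) y := by
  rw [hasGradientAt_iff_hasFDerivAt]
  have h1 := ((hasStrictFDerivAt_norm_sq (y - x)).hasFDerivAt.comp y
    ((hasFDerivAt_id y).sub_const x)).pow 2
  refine (h1.congr_fderiv ?_).congr_of_eventuallyEq (.of_forall fun z => ?_)
  · ext z
    simp
    ring
  · simp only [Function.comp, id]
    ring

theorem hasFDerivAt_norm_sq_smul {N : ℕ} (x : EN N) :
    HasFDerivAt (fun y : EN N => (4 * ‖y - x‖ ^ 2) • (y - x)) (0 : EN N →L[ℝ] EN N) x := by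
  have h0 : HasFDerivAt (fun y : EN N => y - x) (ContinuousLinearMap.id ℝ (EN N)) x :=
    (hasFDerivAt_id x).sub_const x
  have h1 := (h0.norm_sq.const_mul 4).smul h0
  refine HasFDerivAt.congr_fderiv h1 ?_
  ext z
  simp

/-- Truncation of `g` to a Lipschitz bump supported in a ball, provided `g` is bounded above on
the ball and nonpositive on an annulus. -/
theorem exists_truncation {N : ℕ} {v : EN N → ℝ} {x : EN N} {r s δ : ℝ} (hsr : s < r)
    (hδ : 0 ≤ δ) {K : NNReal} (hv : LipschitzOnWith K v (closedBall x r))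
    (hle : ∀ y ∈ closedBall x r, v y ≤ δ)
    (hann : ∀ y ∈ closedBall x r, s ≤ dist y x → v y ≤ 0) :
    ∃ (η : EN N → ℝ) (K' : NNReal), LipschitzWith K' η ∧ (∀ y, 0 ≤ η y) ∧
      (∀ y ∈ ball x s, η y = max 0 (v y)) ∧ (∀ y ∉ ball x s, η y = 0) := by
  obtain ⟨g, hg, hgv⟩ := hv.extend_real
  let c : NNReal := ⟨δ / (r - s), div_nonneg hδ (sub_pos.2 hsr).le⟩
  have hlin : LipschitzWith c fun y => c * (r - dist y x) := by
    refine LipschitzWith.of_dist_le_mul fun y z => ?_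
    rw [Real.dist_eq, ← mul_sub, abs_mul, abs_of_nonneg c.coe_nonneg]
    gcongr
    rw [show r - dist y x - (r - dist z x) = dist z x - dist y x by ring, abs_sub_comm]
    exact abs_dist_sub_le y z x
  refine ⟨fun y => max 0 (min (g y) (c * (r - dist y x))), _, (hg.min hlin).const_max 0,
    fun y => le_max_left _ _, fun y hy => ?_, fun y hy => ?_⟩
  · have hy' : y ∈ closedBall x r := ball_subset_closedBall (ball_subset_ball hsr.le hy)
    have h1 : δ ≤ c * (r - dist y x) := by
      have : δ = c * (r - s) := by
        change δ = δ / (r - s) * (r - s)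
        rw [div_mul_cancel₀ _ (sub_pos.2 hsr).ne']
      rw [this]
      have := (mem_ball.1 hy).le
      gcongr
    dsimp only
    rw [min_eq_left, hgv hy']
    rw [← hgv hy']
    exact (hle y hy').trans h1
  · refine max_eq_left ?_
    by_cases hy' : y ∈ closedBall x r
    · refine (min_le_left _ _).trans ?_
      rw [← hgv hy']
      exact hann y hy' (not_lt.1 hy)
    · refine (min_le_right _ _).trans ?_
      rw [mem_closedBall, not_le] at hy'
      exact mul_nonpos_of_nonneg_of_nonpos c.2 (by linarith)

theorem subsolution_of_minimizer {N : ℕ} {Ω : Set (EN N)} (hΩo : IsOpen Ω)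
    (hΩb : Bornology.IsBounded Ω) {ψ : EN N → ℝ} {f : ℝ → ℝ}
    (hconv : StrictConvexOn ℝ (Ici 0) f)
    (hC1 : ContDiffOn ℝ 1 f (Ici 0)) (hC2 : ContDiffOn ℝ 2 f (Ioi 0)) (h0 : dtop f 0 = 0)
    {u : EN N → ℝ} (hu : SolvesP f Ω ψ u) {x : EN N} (hx : x ∈ Ω) {φ : EN N → ℝ}
    (hφ : ContDiff ℝ 2 φ) (hmax : IsLocalMaxOn (fun y => u y - φ y) Ω x)
    (hp : gradient φ x ≠ 0) :
    -(‖gradient φ x‖ * deriv (dtop f) ‖gradient φ x‖ / dtop f ‖gradient φ x‖ - 1) *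
        ⟪fderiv ℝ (gradient φ) x (gradient φ x), gradient φ x⟫
      - ‖gradient φ x‖ ^ 2 *
        LinearMap.trace ℝ (EN N) (fderiv ℝ (gradient φ) x).toLinearMap ≤ 0 := by
  by_contra! hF
  obtain ⟨⟨L, hL⟩, hbd, hmin⟩ := hu
  have hΩx : Ω ∈ 𝓝 x := hΩo.mem_nhds hx
  let P : EN N → EN N := fun y => gradient φ y + (4 * ‖y - x‖ ^ 2) • (y - x)
  have hgφ := contDiff_gradient hφ
  have hP : ContDiff ℝ 1 P := by
    have h1 : ContDiff ℝ 1 fun y : EN N => y - x := contDiff_id.sub contDiff_const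
    exact hgφ.add ((contDiff_const.mul (h1.norm_sq ℝ)).smul h1)
  have hH : HasFDerivAt P (fderiv ℝ (gradient φ) x) x := by
    exact ((hgφ.differentiable one_ne_zero x).hasFDerivAt.add
      (hasFDerivAt_norm_sq_smul x)).congr_fderiv (add_zero _)
  obtain ⟨V, hV, hVc, hVΩ, hVx⟩ := exists_flux_field hconv hC1 hC2 h0 hP hH (by simp [P]) hp hΩx hF
  rw [IsLocalMaxOn, IsMaxFilter, nhdsWithin_eq_nhds.2 hΩx] at hmax
  obtain ⟨r, hr, hball⟩ := nhds_basis_closedBall.mem_iff.1 (inter_mem hΩx (inter_mem hmax hVx))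
  have hbΩ : closedBall x r ⊆ Ω := fun y hy => (hball hy).1
  have hsr : r / 2 < r := by linarith
  have hbb : ball x (r / 2) ⊆ closedBall x r :=
    (ball_subset_ball hsr.le).trans ball_subset_closedBall
  -- The strict upper test function, lowered so that `u` exceeds it only near `x`.
  let θ : EN N → ℝ := fun y => φ y + ‖y - x‖ ^ 4 + (u x - φ x - (r / 2) ^ 4)
  have hθg : ∀ y, HasGradientAt θ (P y) y := fun y => by
    rw [hasGradientAt_iff_hasFDerivAt]
    have h1 := (hφ.differentiable two_ne_zero y).hasGradientAt.hasFDerivAt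
    have h2 := (hasGradientAt_norm_sub_pow_four x y).hasFDerivAt
    exact ((h1.add h2).add_const (u x - φ x - (r / 2) ^ 4)).congr_fderiv (map_add _ _ _).symm
  obtain ⟨Kθ, hKθ⟩ : ∃ K, LipschitzOnWith K θ (closedBall x r) := by
    have h1 : ContDiff ℝ 1 fun y : EN N => ‖y - x‖ ^ 4 := by
      have : ContDiff ℝ 1 fun y : EN N => (‖y - x‖ ^ 2) ^ 2 :=
        ((contDiff_id.sub contDiff_const).norm_sq ℝ).pow 2
      convert this using 2
      ring
    have h2 : ContDiff ℝ 1 θ := ((hφ.of_le (by norm_num)).add h1).add contDiff_const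
    exact h2.contDiffOn.exists_lipschitzOnWith one_ne_zero (convex_closedBall x r)
      (isCompact_closedBall x r)
  have hv : LipschitzOnWith (L + Kθ) (fun y => u y - θ y) (closedBall x r) :=
    (hL.mono (hbΩ.trans subset_closure)).sub hKθ
  have hvle : ∀ y ∈ closedBall x r, u y - θ y ≤ (r / 2) ^ 4 - ‖y - x‖ ^ 4 := fun y hy => by
    have : u y - φ y ≤ u x - φ x := (hball hy).2.1
    simp only [θ]
    linarith
  obtain ⟨η, K, hη, hη0, hηin, hηout⟩ := exists_truncation hsr (δ := (r / 2) ^ 4)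
    (by positivity) hv (fun y hy => (hvle y hy).trans (by simp)) (fun y hy hs => by
      refine (hvle y hy).trans ?_
      rw [dist_eq_norm] at hs
      have : (r / 2) ^ 4 ≤ ‖y - x‖ ^ 4 := by gcongr
      linarith)
  let w : EN N → ℝ := fun y => u y - η y
  have hwlip : LipOn w (closure Ω) := ⟨L + K, hL.sub hη.lipschitzOnWith⟩
  have hwbd : EqOn w ψ (frontier Ω) := fun y hy => by
    have hyΩ : y ∉ Ω := (hΩo.frontier_eq ▸ hy).2
    simp [w, hηout y fun h => hyΩ (hbΩ (hbb h)), hbd hy]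
  have hJ := hmin w hwlip hwbd
  obtain ⟨hGint, hG⟩ := integral_lineDeriv_sum_eq hη hV hVc
  set G : EN N → ℝ := fun y => ∑ i, lineDeriv ℝ η y (EuclideanSpace.single i 1) * V y i with hGdef
  have hGpos : 0 < ∫ y, G y := by
    rw [hG, ← integral_neg]
    have hc : Continuous fun y => LinearMap.trace ℝ (EN N) (fderiv ℝ V y).toLinearMap :=
      (LinearMap.continuous_of_finiteDimensional
        ((LinearMap.trace ℝ (EN N)).comp (ContinuousLinearMap.coeLM ℝ))).comp
        (hV.continuous_fderiv one_ne_zero)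
    have hxs : x ∈ ball x (r / 2) := mem_ball_self (half_pos hr)
    refine Continuous.integral_pos_of_hasCompactSupport_nonneg_nonzero (x := x)
      (hc.mul hη.continuous).neg ?_ ?_ ?_
    · refine HasCompactSupport.of_support_subset_isCompact (isCompact_closedBall x r) fun y hy => ?_
      by_contra hyb
      exact hy (by simp [hηout y fun h => hyb (hbb h)])
    · intro y
      by_cases hy : y ∈ ball x (r / 2)
      · have h1 := (hball (hbb hy)).2.2.2.2
        simpa using mul_nonpos_of_nonpos_of_nonneg h1.le (hη0 y)
      · simp [hηout y hy]
    · have h1 := (hball (hbb hxs)).2.2.2.2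
      have h2 : 0 < η x := by
        rw [hηin x hxs]
        refine lt_max_of_lt_right ?_
        simp only [θ, sub_self, norm_zero]
        have : 0 < (r / 2) ^ 4 := by positivity
        linarith
      exact neg_ne_zero.2 (mul_ne_zero h1.ne h2.ne')
  have hGΩ : ∫ y in Ω, G y = ∫ y, G y :=
    setIntegral_eq_integral_of_forall_compl_eq_zero fun y hy => by simp [G, hVΩ y hy]
  have hfc := hC1.continuousOn
  have hwint := integrableOn_lagrangian hΩo hΩb hfc hwlip
  have huint := integrableOn_lagrangian hΩo hΩb hfc ⟨L, hL⟩
  have hpt : ∀ᵐ y ∂(volume.restrict Ω), f ‖gradient w y‖ + G y ≤ f ‖gradient u y‖ := by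
    have hud := (hL.mono subset_closure).ae_differentiableWithinAt (μ := volume)
      hΩo.measurableSet
    filter_upwards [hud, ae_restrict_mem hΩo.measurableSet,
      ae_restrict_of_ae hη.ae_differentiableAt] with y hyu hyΩ hyη
    replace hyu := hyu.differentiableAt (hΩo.mem_nhds hyΩ)
    have hGy : G y = ⟪V y, gradient η y⟫ := (inner_gradient_eq_sum hyη (V y)).symm
    have hgw : gradient w y = gradient u y - gradient η y :=
      HasGradientAt.gradient (by
        rw [hasGradientAt_iff_hasFDerivAt, map_sub]
        exact hyu.hasGradientAt.hasFDerivAt.sub hyη.hasGradientAt.hasFDerivAt)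
    rw [hGy]
    rcases (hη0 y).eq_or_lt with hz | hpos
    · have h1 : gradient η y = 0 := by
        have : IsLocalMin η y := Eventually.of_forall fun z => hz ▸ hη0 z
        simp [gradient, this.fderiv_eq_zero]
      simp [hgw, h1]
    · have hyb : y ∈ ball x (r / 2) := by
        by_contra h
        exact hpos.ne' (hηout y h)
      have hwθ : w =ᶠ[𝓝 y] θ := by
        filter_upwards [isOpen_ball.mem_nhds hyb,
          hη.continuous.continuousAt.eventually_const_lt hpos] with z hz hz0
        have h1 := hηin z hz
        rcases max_choice 0 (u z - θ z) with h | h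
        · exact absurd (h1.trans h) hz0.ne'
        · simp only [w, h1.trans h]
          ring
      have hgP : gradient w y = P y := (hwθ.gradient_eq).trans (hθg y).gradient
      obtain ⟨hPy, hVy, -⟩ := (hball (hbb hyb)).2.2
      have := radial_tangent_le hconv hC1 h0 (q := gradient u y) hPy
      rwa [← hVy, ← hgP, hgw, sub_sub_cancel, ← hgw] at this
  have hfin : J f Ω w + ∫ y in Ω, G y ≤ J f Ω u := by
    unfold J
    rw [← integral_add hwint hGint.integrableOn]
    exact integral_mono_ae (hwint.add hGint.integrableOn) huint hpt
  rw [hGΩ] at hfin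
  linarith

theorem gradient_neg_fun {N : ℕ} (w : EN N → ℝ) :
    gradient (fun y => -w y) = fun x => -gradient w x := by
  ext1 x
  simp [gradient, fderiv_fun_neg]

theorem SolvesP.neg {N : ℕ} {f : ℝ → ℝ} {Ω : Set (EN N)} {ψ u : EN N → ℝ}
    (hu : SolvesP f Ω ψ u) : SolvesP f Ω (fun y => -ψ y) (fun y => -u y) := by
  obtain ⟨⟨L, hL⟩, hbd, hmin⟩ := hu
  have hJ : ∀ w : EN N → ℝ, J f Ω (fun y => -w y) = J f Ω w := fun w => by
    simp [J, gradient_neg_fun]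
  refine ⟨⟨L, hL.neg⟩, fun y hy => congrArg Neg.neg (hbd hy), fun w ⟨K, hK⟩ hwb => ?_⟩
  rw [hJ, ← hJ w]
  exact hmin _ ⟨K, hK.neg⟩ fun y hy => by simp [hwb hy]

/-- The Lipschitz minimizer `uₐ` of `Jₐ(w) = ∫_Ω fₐ(‖∇w‖)` with boundary
values `ψ`, for a smooth strictly convex Lagrangian `fₐ` with `f'ₐ(0) = 0`, is a viscosity
solution of `−[αₐ(‖∇u‖) − 1]·Δ∞u − ‖∇u‖²·Δu = 0`. -/
theorem approx_minimizer_is_viscositySolution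
    (N : ℕ) (Ω : Set (EN N)) (hΩo : IsOpen Ω) (hΩb : Bornology.IsBounded Ω)
    (ψ : EN N → ℝ) (hψ : ContinuousOn ψ (frontier Ω))
    (fa : ℝ → ℝ)
    (hconv : StrictConvexOn ℝ (Set.Ici 0) fa)
    (hC1 : ContDiffOn ℝ 1 fa (Set.Ici 0))
    (hC2 : ContDiffOn ℝ 2 fa (Set.Ioi 0))
    (hHolder : ∃ lam : NNReal, 0 < lam ∧ lam < 1 ∧ ∀ K : Set ℝ, IsCompact K →
      K ⊆ Set.Ioi 0 → ∃ C : NNReal, HolderOnWith C lam (deriv (dtop fa)) K)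
    (h0 : dtop fa 0 = 0)
    (ℓ : ℝ)
    (hlim : Tendsto (fun ρ => ρ * deriv (dtop fa) ρ / dtop fa ρ)
      (nhdsWithin 0 (Set.Ioi 0)) (nhds ℓ))
    (α : ℝ → ℝ)
    (hα : ∀ ρ : ℝ, α ρ = if ρ = 0 then ℓ else ρ * deriv (dtop fa) ρ / dtop fa ρ)
    (ua : EN N → ℝ) (hua : SolvesP fa Ω ψ ua) :
    ViscositySol Ω
      (fun p H => -(α ‖p‖ - 1) * ⟪H p, p⟫
        - ‖p‖ ^ 2 * LinearMap.trace ℝ (EN N) H.toLinearMap) ua := by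
  have hcont : ContinuousOn ua Ω := by
    obtain ⟨⟨L, hL⟩, -⟩ := hua
    exact hL.continuousOn.mono subset_closure
  refine ⟨hcont, fun x hx φ hφ hmax => ?_, fun x hx φ hφ hmin => ?_⟩
  · by_cases hp : gradient φ x = 0
    · simp [hp]
    · have := subsolution_of_minimizer hΩo hΩb hconv hC1 hC2 h0 hua hx hφ hmax hp
      simpa only [hα, if_neg (norm_ne_zero_iff.2 hp)] using this
  · by_cases hp : gradient φ x = 0
    · simp [hp]
    · have hmax : IsLocalMaxOn (fun y => -ua y - -φ y) Ω x := by
        refine hmin.neg.congr (.of_forall fun y => ?_) hx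
        ring
      have := subsolution_of_minimizer hΩo hΩb hconv hC1 hC2 h0 hua.neg hx hφ.neg hmax
        (by simpa [gradient_neg_fun] using hp)
      simp only [gradient_neg_fun, norm_neg, fderiv_fun_neg, ContinuousLinearMap.toLinearMap_neg,
        map_neg, neg_apply, inner_neg_left, inner_neg_right] at this
      simp only [hα, if_neg (norm_ne_zero_iff.2 hp)]
      linarith
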